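/- arXiv:math/0504547 — 3 statements merged into one kernel-verified Lean document; each statement's English description precedes it below -/
import Mathlib

section
/- Let (Q,I) be a gentle quiver over a field K and A = KQ/I the corresponding gentle algebra. Then the Smith normal form over ℤ of the ordinary Cartan matrix C_A is the diagonal matrix with oc(Q,I) diagonal entries equal to 2, ec(Q,I) diagonal entries equal to 0, and all remaining diagonal entries equal to 1; equivalently, the elementary divisors of C_A over ℤ are 2 with multiplicity oc(Q,I), 0 with multiplicity ec(Q,I), and 1 otherwise. -/
/-! Combinatorial model of a finite quiver with (quadratic monomial) relations.

For a monomial algebra `A = KQ/I` (with `I` generated by paths of length 2),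
a basis of `e_i A e_j` is given by the paths from `i` to `j` avoiding the
relations, so all Cartan-type invariants are encoded combinatorially. -/

/-- A finite quiver together with a set of quadratic (length two) monomial
relations: `rel a b` means that the length-two path `ab` belongs to the
relation ideal `I`. -/
structure QuivRel where
  /-- vertices -/
  V : Type
  /-- arrows -/
  A : Type
  [instVFin : Fintype V]
  [instVDec : DecidableEq V]
  [instAFin : Fintype A]
  [instADec : DecidableEq A]
  /-- start vertex of an arrow -/
  src : A → V
  /-- end vertex of an arrow -/
  tgt : A → V
  /-- the set of length-two zero relations -/
  rel : A → A → Prop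
  rel_comp : ∀ a b, rel a b → tgt a = src b

attribute [instance] QuivRel.instVFin QuivRel.instVDec QuivRel.instAFin QuivRel.instADec

namespace QuivRel

variable (G : QuivRel)

/-- Condition (i) and (ii): `(Q,I)` is special biserial (the relation ideal `I`
being generated by the paths of length two recorded in `rel`). -/
def SpecialBiserial : Prop :=
  (∀ v : G.V, Nat.card {a : G.A // G.src a = v} ≤ 2) ∧
  (∀ v : G.V, Nat.card {a : G.A // G.tgt a = v} ≤ 2) ∧
  (∀ a b c : G.A, G.tgt a = G.src b → ¬ G.rel a b → G.tgt a = G.src c → ¬ G.rel a c → b = c) ∧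
  (∀ a b c : G.A, G.tgt b = G.src a → ¬ G.rel b a → G.tgt c = G.src a → ¬ G.rel c a → b = c)

/-- `(Q,I)` is a gentle quiver: special biserial, `I` generated by paths of
length two (built into the data), and conditions (iv). -/
def Gentle : Prop :=
  G.SpecialBiserial ∧
  (∀ a b c : G.A, G.rel a b → G.rel a c → b = c) ∧
  (∀ a b c : G.A, G.rel b a → G.rel c a → b = c)

/-- A (composable) path all of whose length-two subpaths avoid the relations;
these are exactly the paths which are nonzero in the monomial algebra `KQ/I`. -/
def IsNonzeroPath (p : List G.A) : Prop :=
  p.Chain' (fun a b => G.tgt a = G.src b ∧ ¬ G.rel a b)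

/-- Nonzero paths from `i` to `j`; the empty list is the trivial path `e_i`
(so we require `i = j` for it). -/
def IsNonzeroPathFrom (i j : G.V) (p : List G.A) : Prop :=
  G.IsNonzeroPath p ∧ (∀ a ∈ p.head?, G.src a = i) ∧
    (∀ a ∈ p.getLast?, G.tgt a = j) ∧ (p = [] → i = j)

/-- Finite-dimensionality of `KQ/I`: nonzero paths have bounded length. -/
def FinDim : Prop := ∃ N, ∀ p : List G.A, G.IsNonzeroPath p → p.length ≤ N

/-- The `q`-Cartan matrix of `A = KQ/I`: the `(i,j)`-entry is the Poincaré
polynomial `∑_n dim_K (e_i A e_j)_n qⁿ`, i.e. each nonzero path from `i` to `j`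
contributes `q^(its length)`. -/
noncomputable def qCartan : Matrix G.V G.V (Polynomial ℤ) := fun i j =>
  ∑ᶠ n : ℕ,
    (Nat.card {p : List G.A // p.length = n ∧ G.IsNonzeroPathFrom i j p} : Polynomial ℤ) *
      Polynomial.X ^ n

/-- The ordinary Cartan matrix of `A = KQ/I`: the `(i,j)`-entry is
`dim_K e_i A e_j`, the number of nonzero paths from `i` to `j`. -/
noncomputable def cartan : Matrix G.V G.V ℤ := fun i j =>
  (Nat.card {p : List G.A // G.IsNonzeroPathFrom i j p} : ℤ)

/-- An oriented cycle with full zero relations, recorded as the (nonempty) list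
of its arrows: any two cyclically consecutive arrows form a relation (this in
particular forces consecutive arrows to be composable, and the start and end
points to agree). -/
def IsZeroCycle (p : List G.A) : Prop :=
  p ≠ [] ∧ ∀ i : Fin p.length,
    G.rel (p.get i) (p.get ⟨(i.1 + 1) % p.length,
      Nat.mod_lt _ (Nat.lt_of_le_of_lt (Nat.zero_le _) i.2)⟩)

/-- A minimal oriented cycle with full zero relations: its arrows are pairwise
distinct. -/
def IsMinZeroCycle (p : List G.A) : Prop := G.IsZeroCycle p ∧ p.Nodup

/-- Lists satisfying a property, up to cyclic rotation. Oriented cycles are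
sequences of arrows up to cyclic rotation. -/
def cycleSetoid (P : List G.A → Prop) : Setoid {p : List G.A // P p} :=
  Setoid.comap Subtype.val (List.IsRotated.setoid G.A)

/-- `c_k`, the number of minimal oriented `k`-cycles in `Q` with full zero
relations (cycles being counted up to cyclic rotation). -/
noncomputable def numCycles (k : ℕ) : ℕ :=
  Nat.card (Quotient (G.cycleSetoid (fun p => G.IsMinZeroCycle p ∧ p.length = k)))

/-- The total number of minimal oriented cycles in `Q` with full zero relations. -/
noncomputable def totalCycles : ℕ :=
  Nat.card (Quotient (G.cycleSetoid (fun p => G.IsMinZeroCycle p)))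

/-- `ec(Q,I)`, the number of minimal oriented cycles with full zero relations
of even length. -/
noncomputable def ec : ℕ :=
  Nat.card (Quotient (G.cycleSetoid (fun p => G.IsMinZeroCycle p ∧ Even p.length)))

/-- `oc(Q,I)`, the number of minimal oriented cycles with full zero relations
of odd length. -/
noncomputable def oc : ℕ :=
  Nat.card (Quotient (G.cycleSetoid (fun p => G.IsMinZeroCycle p ∧ Odd p.length)))

end QuivRel

/-- Two square matrices over a commutative ring are unimodularly equivalent if
they differ by multiplication by matrices of determinant `1` on either side. -/
def UnimodEquiv {n : Type} [Fintype n] [DecidableEq n] {R : Type} [CommRing R]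
    (C D : Matrix n n R) : Prop :=
  ∃ P Q : Matrix n n R, P.det = 1 ∧ Q.det = 1 ∧ D = P * C * Q

lemma LinearMap.exists_basis_smul {ι M : Type*} [Finite ι] [AddCommGroup M]
    (b : Module.Basis ι ℤ M) (g : M →ₗ[ℤ] M) :
    ∃ (b₁ b₂ : Module.Basis ι ℤ M) (d : ι → ℤ), ∀ i, g (b₁ i) = d i • b₂ i := by
  classical
  have := Fintype.ofFinite ι
  obtain ⟨n, s⟩ := Submodule.smithNormalForm b (LinearMap.range g)
  obtain ⟨k, bK⟩ := Submodule.basisOfPid b (LinearMap.ker g)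
  have : Module.Free ℤ (LinearMap.range g) := Module.Free.of_basis s.bN
  obtain ⟨h, hh⟩ := Module.projective_lifting_property g.rangeRestrict LinearMap.id
    g.surjective_rangeRestrict
  obtain ⟨e, he₁, he₂⟩ := Function.Exact.splitSurjectiveEquiv
    (f := (LinearMap.ker g).subtype) (g := g.rangeRestrict)
    (by rw [LinearMap.exact_iff]; simp) Subtype.val_injective ⟨h, hh⟩
  have hk (x) : g (e.symm (x, 0)) = 0 := by
    have := LinearMap.congr_fun he₁ x
    simp only [Submodule.coe_subtype, LinearMap.comp_apply, LinearMap.inl_apply,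
      LinearEquiv.coe_coe] at this
    rw [← this]
    exact x.2
  have hr (y) : g (e.symm (0, y)) = y := by
    have := congrArg Subtype.val (LinearMap.congr_fun he₂ (e.symm (0, y)))
    simpa using this
  let b₁ := (bK.prod s.bN).map e.symm
  have hcard : Fintype.card (Fin k ⊕ Fin n) = Fintype.card ι :=
    Fintype.card_congr (b₁.indexEquiv b)
  have hcompl : Fintype.card (Fin k) = Fintype.card ((Set.range s.f)ᶜ : Set ι) := by
    have h₁ := Fintype.card_congr (Equiv.Set.sumCompl (Set.range s.f))
    have h₂ := Fintype.card_congr (Equiv.ofInjective s.f s.f.injective)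
    simp only [Fintype.card_sum] at h₁ hcard
    omega
  let E : Fin k ⊕ Fin n ≃ ι := (Equiv.sumComm _ _).trans <|
    (Equiv.sumCongr (Equiv.ofInjective s.f s.f.injective) (Fintype.equivOfCardEq hcompl)).trans <|
      Equiv.Set.sumCompl (Set.range s.f)
  have hE (j) : E (Sum.inr j) = s.f j := by simp [E]
  refine ⟨b₁.reindex E, s.bM, fun i => Sum.elim 0 s.a (E.symm i), fun i => ?_⟩
  obtain ⟨j, rfl⟩ := E.surjective i
  rcases j with j | j
  · simp [b₁, hk]
  · have hb : b₁ (Sum.inr j) = e.symm (0, s.bN j) := by simp [b₁]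
    rw [Module.Basis.reindex_apply, E.symm_apply_apply, hb, hr, s.snf]
    simp only [E.symm_apply_apply, Sum.elim_inr]
    rw [hE]

namespace Matrix

variable {m n F : Type*} [Fintype m] [DecidableEq m] [Fintype n] [DecidableEq n]

lemma exists_mul_mul_eq_diagonal_int (C : Matrix n n ℤ) :
    ∃ (P Q : Matrix n n ℤ) (d : n → ℤ),
      IsUnit P.det ∧ IsUnit Q.det ∧ P * C * Q = diagonal d := by
  let b := Pi.basisFun ℤ n
  obtain ⟨b₁, b₂, d, h⟩ := LinearMap.exists_basis_smul b (toLin' C)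
  refine ⟨b₂.toMatrix b, b.toMatrix b₁, d, ?_, ?_, ?_⟩
  · exact isUnit_det_of_right_inverse (b₂.toMatrix_mul_toMatrix_flip b)
  · exact isUnit_det_of_right_inverse (b.toMatrix_mul_toMatrix_flip b₁)
  · have hC : C = LinearMap.toMatrix b b (toLin' C) := by
      rw [LinearMap.toMatrix_eq_toMatrix', LinearMap.toMatrix'_toLin']
    conv_lhs => rw [hC]
    rw [basis_toMatrix_mul_linearMap_toMatrix_mul_basis_toMatrix]
    ext i j
    rw [LinearMap.toMatrix_apply, h, map_smul, Module.Basis.repr_self, Finsupp.smul_single,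
      smul_eq_mul, mul_one, Finsupp.single_apply, diagonal_apply]
    by_cases hij : i = j
    · simp [hij]
    · simp [hij, Ne.symm hij]

lemma det_one_add_eq_one_of_lt {R : Type*} [CommRing R] (N : Matrix n n R) (h : n → ℕ)
    (hN : ∀ a b, N a b ≠ 0 → h b < h a) : (1 + N).det = 1 := by
  have h₀ (a) : N a a = 0 := by
    by_contra ha
    exact (hN a a ha).false
  rw [det_apply, Finset.sum_eq_single 1]
  · simp [h₀]
  · intro σ _ hσ
    suffices ∃ a, (1 + N) (σ a) a = 0 by
      obtain ⟨a, ha⟩ := this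
      exact smul_eq_zero_of_right _ (Finset.prod_eq_zero (Finset.mem_univ a) ha)
    by_contra! hne
    have hlt (a) (ha : σ a ≠ a) : h a < h (σ a) := hN _ _ <| by
      simpa [one_apply_ne ha] using hne a
    obtain ⟨a, ha⟩ : ∃ a, σ a ≠ a := by
      contrapose! hσ
      exact Equiv.ext hσ
    refine (Finset.sum_lt_sum (f := h) (g := fun a => h (σ a)) (fun a _ => ?_)
      ⟨a, Finset.mem_univ a, hlt a ha⟩).ne (Equiv.sum_comp σ h).symm
    by_cases ha : σ a = a
    · rw [ha]
    · exact (hlt a ha).le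
  · simp

lemma rank_one_add_mul_comm [Field F] (X : Matrix m n F) (Y : Matrix n m F) :
    (1 + X * Y).rank + Fintype.card n = (1 + Y * X).rank + Fintype.card m := by
  have key (e : LinearMap.ker (1 + X * Y).mulVecLin ≃ₗ[F] LinearMap.ker (1 + Y * X).mulVecLin) :
      (1 + X * Y).rank + Fintype.card n = (1 + Y * X).rank + Fintype.card m := by
    have h₁ := (1 + X * Y).mulVecLin.finrank_range_add_finrank_ker
    have h₂ := (1 + Y * X).mulVecLin.finrank_range_add_finrank_ker
    have h₃ := e.finrank_eq
    simp only [Module.finrank_fintype_fun_eq_card] at h₁ h₂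
    simp only [rank]
    omega
  have hX (x) : x ∈ LinearMap.ker (1 + X * Y).mulVecLin ↔ X *ᵥ Y *ᵥ x = -x := by
    rw [LinearMap.mem_ker, mulVecLin_apply, add_mulVec, one_mulVec, ← mulVec_mulVec, add_comm,
      add_eq_zero_iff_eq_neg]
  have hY (y) : y ∈ LinearMap.ker (1 + Y * X).mulVecLin ↔ Y *ᵥ X *ᵥ y = -y := by
    rw [LinearMap.mem_ker, mulVecLin_apply, add_mulVec, one_mulVec, ← mulVec_mulVec, add_comm,
      add_eq_zero_iff_eq_neg]
  refine key (LinearEquiv.ofLinearMap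
    (Y.mulVecLin.restrict fun x hx => (hY _).2 ?_)
    ((-X).mulVecLin.restrict fun y hy => (hX _).2 ?_) ?_ ?_)
  · rw [mulVecLin_apply, (hX x).1 hx, mulVec_neg]
  · rw [mulVecLin_apply, neg_mulVec, mulVec_neg, (hY y).1 hy, mulVec_neg, mulVec_neg]
  · ext1 ⟨y, hy⟩
    apply Subtype.ext
    have := (hY y).1 hy
    simp [mulVec_neg, this]
  · ext1 ⟨y, hy⟩
    apply Subtype.ext
    have := (hX y).1 hy
    simp [this]

lemma exists_mul_mul_eq_two_smul_comm {R : Type*} [CommRing R] (X : Matrix m n R)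
    (Y : Matrix n m R)
    (h : ∃ Z, (1 + X * Y) * Z * (1 + X * Y) = (2 : R) • (1 + X * Y)) :
    ∃ Z, (1 + Y * X) * Z * (1 + Y * X) = (2 : R) • (1 + Y * X) := by
  obtain ⟨Z, hZ⟩ := h
  refine ⟨(2 : R) • 1 - Y * Z * X, ?_⟩
  have h₁ : (1 + Y * X) * Y = Y * (1 + X * Y) := by
    simp [Matrix.add_mul, Matrix.mul_add, Matrix.mul_assoc]
  have h₂ : X * (1 + Y * X) = (1 + X * Y) * X := by
    simp [Matrix.add_mul, Matrix.mul_add, Matrix.mul_assoc]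
  have h₃ : (1 + Y * X) * (Y * Z * X) * (1 + Y * X) = (2 : R) • (Y * X * (1 + Y * X)) := calc
    _ = ((1 + Y * X) * Y) * Z * (X * (1 + Y * X)) := by simp only [Matrix.mul_assoc]
    _ = Y * ((1 + X * Y) * Z * (1 + X * Y)) * X := by rw [h₁, h₂]; simp only [Matrix.mul_assoc]
    _ = _ := by
      rw [hZ, Matrix.mul_smul, Matrix.smul_mul, ← h₁, Matrix.mul_assoc Y X, h₂]
      rw [← Matrix.mul_assoc, h₁]
  rw [Matrix.mul_sub, Matrix.sub_mul, h₃, Matrix.mul_smul, Matrix.mul_one, Matrix.smul_mul,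
    ← smul_sub, ← Matrix.sub_mul, add_sub_cancel_right, Matrix.one_mul]

lemma unimodEquiv_diagonal_of_nonneg {n : Type} [Fintype n] [DecidableEq n]
    {C P Q : Matrix n n ℤ} {d : n → ℤ} (hdet : 0 ≤ C.det) (hP : IsUnit P.det) (hQ : IsUnit Q.det)
    (h : P * C * Q = diagonal d) (hd : ∀ v, 0 ≤ d v) : UnimodEquiv C (diagonal d) := by
  have hPQ : P.det * C.det * Q.det = ∏ v, d v := by
    rw [← det_mul, ← det_mul, h, det_diagonal]
  rcases isEmpty_or_nonempty n with _ | ⟨⟨v₀⟩⟩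
  · exact ⟨P, Q, det_isEmpty, det_isEmpty, h.symm⟩
  have hP' := Int.isUnit_iff.1 hP
  have hQ' := Int.isUnit_iff.1 hQ
  obtain ⟨v, hv⟩ : ∃ v, P.det * d v * Q.det = d v := by
    by_cases h₀ : ∃ v, d v = 0
    · obtain ⟨v, hv⟩ := h₀
      exact ⟨v, by simp [hv]⟩
    · push Not at h₀
      have hpos : 0 < ∏ v, d v := Finset.prod_pos fun v _ => (hd v).lt_of_ne' (h₀ v)
      refine ⟨v₀, ?_⟩
      rw [← hPQ] at hpos
      rcases hP' with e | e <;> rcases hQ' with e' | e' <;> rw [e, e'] at hpos ⊢ <;> grind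
  have hJ (x : ℤ) : (diagonal (Function.update (1 : n → ℤ) v x)).det = x := by
    rw [det_diagonal, Finset.prod_update_of_mem (Finset.mem_univ v)]
    simp
  refine ⟨diagonal (Function.update 1 v P.det) * P, Q * diagonal (Function.update 1 v Q.det),
    ?_, ?_, ?_⟩
  · rw [det_mul, hJ]
    exact Int.isUnit_mul_self hP
  · rw [det_mul, hJ]
    exact Int.isUnit_mul_self hQ
  · calc diagonal d = diagonal (Function.update 1 v P.det) * diagonal d *
          diagonal (Function.update 1 v Q.det) := by
          rw [diagonal_mul_diagonal, diagonal_mul_diagonal]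
          congr 1
          ext w
          by_cases hw : w = v
          · subst hw; simp [hv]
          · simp [hw]
      _ = _ := by rw [← h]; simp only [Matrix.mul_assoc]

lemma exists_unimodEquiv_diagonal {n : Type} [Fintype n] [DecidableEq n] (C : Matrix n n ℤ)
    (hdet : 0 ≤ C.det) (hC : ∃ Z, C * Z * C = (2 : ℤ) • C) :
    ∃ d : n → ℤ, UnimodEquiv C (diagonal d) ∧ ∀ v, d v = 0 ∨ d v = 1 ∨ d v = 2 := by
  obtain ⟨P, Q, d, hP, hQ, hd⟩ := exists_mul_mul_eq_diagonal_int C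
  obtain ⟨Z, hZ⟩ := hC
  have hd₂ (v) : d v = 0 ∨ d v ∣ 2 := by
    have h₁ : diagonal d * (Q⁻¹ * Z * P⁻¹) * diagonal d = (2 : ℤ) • diagonal d := calc
      _ = P * C * (Q * Q⁻¹) * Z * (P⁻¹ * P) * C * Q := by
        rw [← hd]; simp only [Matrix.mul_assoc]
      _ = P * (C * Z * C) * Q := by
        rw [mul_nonsing_inv _ hQ, nonsing_inv_mul _ hP]; simp only [Matrix.mul_assoc, Matrix.one_mul]
      _ = _ := by rw [hZ, ← hd, Matrix.mul_smul, Matrix.smul_mul]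
    have h₂ := congrFun (congrFun h₁ v) v
    rw [mul_diagonal, diagonal_mul] at h₂
    simp only [smul_apply, diagonal_apply_eq, smul_eq_mul] at h₂
    by_cases h : d v = 0
    · exact Or.inl h
    · exact Or.inr ⟨_, (mul_right_cancel₀ h h₂).symm⟩
  let s : n → ℤ := fun v => if d v < 0 then -1 else 1
  have hs : IsUnit (diagonal s).det := by
    rw [det_diagonal, IsUnit.prod_univ_iff]
    intro v
    simp only [s]
    split_ifs <;> simp
  have hd₁ : (diagonal s * P) * C * Q = diagonal (fun v => |d v|) := by
    rw [Matrix.mul_assoc, Matrix.mul_assoc, ← Matrix.mul_assoc P, hd, diagonal_mul_diagonal]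
    congr 1
    ext v
    simp only [s]
    split_ifs with h
    · rw [abs_of_neg h, neg_one_mul]
    · rw [abs_of_nonneg (not_lt.1 h), one_mul]
  refine ⟨fun v => |d v|, unimodEquiv_diagonal_of_nonneg hdet
    (by rw [det_mul]; exact hs.mul hP) hQ hd₁ fun v => abs_nonneg _, fun v => ?_⟩
  rcases hd₂ v with h | h
  · simp [h]
  · have h₁ := Int.le_of_dvd two_pos ((abs_dvd _ _).2 h)
    have h₂ := abs_nonneg (d v)
    change |d v| = 0 ∨ |d v| = 1 ∨ |d v| = 2
    omega

end Matrix

namespace List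

variable {α : Type*}

lemma card_eq_ite_add_sum [Fintype α] (P : List α → Prop) [Decidable (P [])]
    [Finite {p // P p}] :
    Nat.card {p // P p} = (if P [] then 1 else 0) + ∑ a, Nat.card {q // P (a :: q)} := by
  classical
  have hfin (a) : Finite {q // P (a :: q)} :=
    Finite.of_injective (β := {p // P p}) (fun q => ⟨a :: q.1, q.2⟩) fun q r h => by
      simpa [Subtype.ext_iff] using h
  let F : {_u : Unit // P []} ⊕ (Σ a, {q // P (a :: q)}) → {p // P p} :=
    Sum.elim (fun u => ⟨[], u.2⟩) fun q => ⟨q.1 :: q.2.1, q.2.2⟩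
  have hF : F.Bijective := by
    constructor
    · rintro (⟨⟨⟩, _⟩ | ⟨a, q, hq⟩) (⟨⟨⟩, _⟩ | ⟨b, r, hr⟩) h <;> simp [F] at h ⊢
      obtain ⟨rfl, rfl⟩ := h
      simp
    · rintro ⟨_ | ⟨a, q⟩, h⟩
      · exact ⟨Sum.inl ⟨(), h⟩, rfl⟩
      · exact ⟨Sum.inr ⟨a, q, h⟩, rfl⟩
  rw [← Nat.card_eq_of_bijective F hF, Nat.card_sum, Nat.card_sigma]
  congr 1
  split_ifs with h <;> simp [h]

end List

namespace QuivRel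

variable {G : QuivRel}

open Matrix

/-- The arrow `b` may follow the arrow `a` in a nonzero path. -/
def Follows (G : QuivRel) (a b : G.A) : Prop := G.tgt a = G.src b ∧ ¬ G.rel a b

/-- The number of nonzero paths that start with the arrow `a` and end at the vertex `j`. -/
noncomputable def pathsFrom (G : QuivRel) : Matrix G.A G.V ℤ := fun a j =>
  (Nat.card {q : List G.A // G.IsNonzeroPathFrom (G.src a) j (a :: q)} : ℤ)

open Classical in
/-- The transition matrix of nonzero paths. -/
noncomputable def followsMatrix (G : QuivRel) : Matrix G.A G.A ℤ :=
  of fun a b => if G.Follows a b then 1 else 0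

open Classical in
/-- The matrix of zero relations. -/
noncomputable def relMatrix (G : QuivRel) : Matrix G.A G.A ℤ :=
  of fun a b => if G.rel a b then 1 else 0

/-- The incidence matrix of vertices and the arrows starting there. -/
def srcMatrix (G : QuivRel) : Matrix G.V G.A ℤ := of fun i a => if G.src a = i then 1 else 0

/-- The incidence matrix of arrows and the vertices where they end. -/
def tgtMatrix (G : QuivRel) : Matrix G.A G.V ℤ := of fun a j => if G.tgt a = j then 1 else 0

lemma isNonzeroPath_iff {p : List G.A} : G.IsNonzeroPath p ↔ p.IsChain G.Follows := Iff.rfl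

lemma FinDim.finite (hfd : G.FinDim) (P : List G.A → Prop) (hP : ∀ p, P p → G.IsNonzeroPath p) :
    Finite {p // P p} := by
  obtain ⟨N, hN⟩ := hfd
  exact ((List.finite_length_le G.A N).subset fun p hp => hN p (hP p hp)).to_subtype

lemma isNonzeroPathFrom_cons_cons {i j : G.V} {a b : G.A} {q : List G.A} :
    G.IsNonzeroPathFrom i j (a :: b :: q) ↔
      G.src a = i ∧ G.Follows a b ∧ G.IsNonzeroPathFrom (G.src b) j (b :: q) := by
  simp [IsNonzeroPathFrom, isNonzeroPath_iff]
  tauto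

lemma cartan_eq (hfd : G.FinDim) : G.cartan = 1 + G.srcMatrix * G.pathsFrom := by
  classical
  ext i j
  have := hfd.finite (G.IsNonzeroPathFrom i j) fun p hp => hp.1
  have h₁ (a) : Nat.card {q // G.IsNonzeroPathFrom i j (a :: q)} =
      if G.src a = i then Nat.card {q // G.IsNonzeroPathFrom (G.src a) j (a :: q)} else 0 := by
    split_ifs with h
    · rw [h]
    · simp [IsNonzeroPathFrom, h]
  have h₂ : G.IsNonzeroPathFrom i j [] ↔ i = j := by
    simp [IsNonzeroPathFrom, isNonzeroPath_iff]
  simp [cartan, List.card_eq_ite_add_sum, h₁, h₂, srcMatrix, pathsFrom, mul_apply, one_apply]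

lemma pathsFrom_eq (hfd : G.FinDim) :
    (1 - G.followsMatrix) * G.pathsFrom = G.tgtMatrix := by
  classical
  rw [Matrix.sub_mul, Matrix.one_mul, sub_eq_iff_eq_add]
  ext a j
  have : Finite {q // G.IsNonzeroPathFrom (G.src a) j (a :: q)} :=
    have := hfd.finite (G.IsNonzeroPathFrom (G.src a) j) fun p hp => hp.1
    Finite.of_injective (β := {p // G.IsNonzeroPathFrom (G.src a) j p})
      (fun q => ⟨a :: q.1, q.2⟩) fun q r h => by simpa [Subtype.ext_iff] using h
  have h₁ (b) : Nat.card {q // G.IsNonzeroPathFrom (G.src a) j (a :: b :: q)} =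
      if G.Follows a b then Nat.card {q // G.IsNonzeroPathFrom (G.src b) j (b :: q)} else 0 := by
    simp only [isNonzeroPathFrom_cons_cons]
    split_ifs with h <;> simp [h]
  have h₂ : G.IsNonzeroPathFrom (G.src a) j [a] ↔ G.tgt a = j := by
    simp [IsNonzeroPathFrom, isNonzeroPath_iff]
  simp [pathsFrom, List.card_eq_ite_add_sum (fun q => G.IsNonzeroPathFrom (G.src a) j (a :: q)),
    h₁, h₂, tgtMatrix, mul_apply, followsMatrix]

lemma tgtMatrix_mul_srcMatrix : G.tgtMatrix * G.srcMatrix = G.followsMatrix + G.relMatrix := by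
  ext a b
  have := G.rel_comp a b
  simp only [tgtMatrix, srcMatrix, followsMatrix, relMatrix, Follows, mul_apply, of_apply,
    Matrix.add_apply]
  by_cases h : G.tgt a = G.src b <;> by_cases h' : G.rel a b <;> simp_all [eq_comm]

lemma one_sub_followsMatrix_mul (hfd : G.FinDim) :
    (1 - G.followsMatrix) * (1 + G.pathsFrom * G.srcMatrix) = 1 + G.relMatrix := by
  rw [Matrix.mul_add, Matrix.mul_one, ← Matrix.mul_assoc, pathsFrom_eq hfd,
    tgtMatrix_mul_srcMatrix]
  abel

lemma det_one_sub_followsMatrix (hfd : G.FinDim) : (1 - G.followsMatrix).det = 1 := by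
  let L (a : G.A) : Set ℕ := {n | ∃ q, G.IsNonzeroPath (a :: q) ∧ q.length = n}
  have hL (a) : sSup (L a) ∈ L a := by
    obtain ⟨N, hN⟩ := hfd
    refine Nat.sSup_mem ⟨0, [], by simp [isNonzeroPath_iff], rfl⟩ ⟨N, ?_⟩
    rintro _ ⟨q, hq, rfl⟩
    have := hN _ hq
    simp at this
    omega
  have hbdd (a) : BddAbove (L a) := by
    obtain ⟨N, hN⟩ := hfd
    refine ⟨N, ?_⟩
    rintro _ ⟨q, hq, rfl⟩
    have := hN _ hq
    simp at this
    omega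
  rw [sub_eq_add_neg]
  refine det_one_add_eq_one_of_lt _ (fun a => sSup (L a)) fun a b hab => ?_
  have hab' : G.Follows a b := by
    by_contra h
    simp [followsMatrix, h] at hab
  obtain ⟨q, hq, hlen⟩ := hL b
  refine Nat.lt_of_succ_le (le_csSup (hbdd a) ⟨b :: q, ?_, by simp [hlen]⟩)
  simpa [isNonzeroPath_iff, hab'] using hq

lemma IsZeroCycle.length_pos {p : List G.A} (hp : G.IsZeroCycle p) : 0 < p.length :=
  List.length_pos_iff.2 hp.1

lemma IsZeroCycle.rel_getElem {p : List G.A} (hp : G.IsZeroCycle p) (n : ℕ) :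
    G.rel (p[n % p.length]'(Nat.mod_lt _ hp.length_pos))
      (p[(n + 1) % p.length]'(Nat.mod_lt _ hp.length_pos)) := by
  simpa using hp.2 ⟨n % p.length, Nat.mod_lt _ hp.length_pos⟩

lemma IsMinZeroCycle.isRotated (hG : G.Gentle) {p q : List G.A} (hp : G.IsMinZeroCycle p)
    (hq : G.IsMinZeroCycle q) {a : G.A} (hap : a ∈ p) (haq : a ∈ q) : p ~r q := by
  obtain ⟨i, hi, rfl⟩ := List.getElem_of_mem hap
  obtain ⟨j, hj, hij⟩ := List.getElem_of_mem haq
  have hpos := hp.1.length_pos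
  have hpos' := hq.1.length_pos
  have key (n : ℕ) : p[(i + n) % p.length]'(Nat.mod_lt _ hpos) =
      q[(j + n) % q.length]'(Nat.mod_lt _ hpos') := by
    induction n with
    | zero => simp [Nat.mod_eq_of_lt, hi, hj, hij]
    | succ n ih =>
      have h₁ := hp.1.rel_getElem (i + n)
      rw [ih] at h₁
      exact hG.2.1 _ _ _ h₁ (hq.1.rel_getElem (j + n))
  have hlen : p.length = q.length := by
    apply Nat.dvd_antisymm
    · have h : p[(i + q.length) % p.length]'(Nat.mod_lt _ hpos) =
          p[(i + 0) % p.length]'(Nat.mod_lt _ hpos) := by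
        rw [key, key]
        simp only [Nat.add_mod_right, add_zero]
      rw [hp.2.getElem_inj_iff] at h
      exact Nat.modEq_zero_iff_dvd.1 (Nat.ModEq.add_left_cancel' i h)
    · have h : q[(j + p.length) % q.length]'(Nat.mod_lt _ hpos') =
          q[(j + 0) % q.length]'(Nat.mod_lt _ hpos') := by
        rw [← key, ← key]
        simp only [Nat.add_mod_right, add_zero]
      rw [hq.2.getElem_inj_iff] at h
      exact Nat.modEq_zero_iff_dvd.1 (Nat.ModEq.add_left_cancel' j h)
  have : p.rotate i = q.rotate j := by
    refine List.ext_getElem (by simp [hlen]) fun n h₁ h₂ => ?_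
    simpa only [List.getElem_rotate, add_comm n] using key n
  exact (List.IsRotated.forall p i).symm.trans (this ▸ List.IsRotated.forall q j)

lemma IsMinZeroCycle.exists_of_transGen (hG : G.Gentle) {r : G.A → G.A → Prop}
    (hr : ∀ a b, r a b → G.rel a b) {a : G.A} (ha : Relation.TransGen r a a) :
    ∃ p, G.IsMinZeroCycle p ∧ ∀ b ∈ p, ∃ c, r b c := by
  classical
  let f (b : G.A) : G.A := if h : ∃ c, r b c then h.choose else b
  have hf {b c} (h : r b c) : f b = c := by
    have h' : ∃ c, r b c := ⟨c, h⟩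
    simp only [f, dif_pos h']
    exact hG.2.1 _ _ _ (hr _ _ h'.choose_spec) (hr _ _ h)
  have hper : a ∈ Function.periodicPts f := by
    have (b) (h : Relation.TransGen r a b) : ∃ n > 0, f^[n] a = b := by
      induction h with
      | single h => exact ⟨1, one_pos, hf h⟩
      | tail _ h ih =>
        obtain ⟨n, hn, rfl⟩ := ih
        exact ⟨n + 1, n.succ_pos, by rw [Function.iterate_succ_apply', hf h]⟩
    exact this a ha
  have hstep (n : ℕ) : Relation.TransGen r (f^[n] a) a := by
    induction n with
    | zero => exact ha
    | succ n ih =>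
      obtain ⟨c, hc, hca⟩ := Relation.TransGen.head'_iff.1 ih
      rw [Function.iterate_succ_apply', hf hc]
      rcases Relation.reflTransGen_iff_eq_or_transGen.1 hca with h | h
      · exact h ▸ ha
      · exact h
  have hrn (n : ℕ) : r (f^[n] a) (f^[n + 1] a) := by
    obtain ⟨c, hc, -⟩ := Relation.TransGen.head'_iff.1 (hstep n)
    rwa [Function.iterate_succ_apply', hf hc]
  let p := (List.range (Function.minimalPeriod f a)).map fun n => f^[n] a
  have hlen : p.length = Function.minimalPeriod f a := by simp [p]
  have hpos := Function.minimalPeriod_pos_of_mem_periodicPts hper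
  refine ⟨p, ⟨⟨List.ne_nil_of_length_pos (hlen ▸ hpos), fun i => hr _ _ ?_⟩, ?_⟩, ?_⟩
  · simp only [p, List.get_eq_getElem, List.getElem_map, List.getElem_range, List.length_map,
      List.length_range, Function.iterate_mod_minimalPeriod_eq]
    exact hrn i
  · simpa [p, Function.periodicOrbit] using Function.nodup_periodicOrbit (f := f) (x := a)
  · intro b hb
    obtain ⟨n, -, rfl⟩ := List.mem_map.1 hb
    exact ⟨_, hrn n⟩

/-- The set of minimal oriented cycles with full zero relations. -/
abbrev MinZeroCycle (G : QuivRel) : Type := Quotient (G.cycleSetoid G.IsMinZeroCycle)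

instance : Finite G.MinZeroCycle :=
  have : Finite {p // G.IsMinZeroCycle p} :=
    Finite.of_injective (β := {p : List G.A // p.Nodup}) (fun p => ⟨p.1, p.2.2⟩) fun p q h => by
      simpa [Subtype.ext_iff] using h
  Quotient.finite _

noncomputable instance : Fintype G.MinZeroCycle := Fintype.ofFinite _

noncomputable instance : DecidableEq G.MinZeroCycle := Classical.decEq _

namespace MinZeroCycle

/-- A list of arrows representing a cycle. -/
noncomputable def arrows (c : G.MinZeroCycle) : List G.A := c.out.1

lemma isMin (c : G.MinZeroCycle) : G.IsMinZeroCycle c.arrows := c.out.2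

/-- The length of a cycle, diminished by one. -/
noncomputable def pred (c : G.MinZeroCycle) : ℕ := c.arrows.length - 1

lemma length_arrows (c : G.MinZeroCycle) : c.arrows.length = c.pred + 1 := by
  have := c.isMin.1.length_pos
  simp only [pred]
  omega

/-- The `n`-th arrow of a cycle, indices being read modulo the length. -/
noncomputable def arrow (c : G.MinZeroCycle) (n : ℕ) : G.A :=
  c.arrows[n % c.arrows.length]'(Nat.mod_lt _ c.isMin.1.length_pos)

lemma arrow_mem (c : G.MinZeroCycle) (n : ℕ) : c.arrow n ∈ c.arrows := List.getElem_mem _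

lemma rel_arrow (c : G.MinZeroCycle) (n : ℕ) : G.rel (c.arrow n) (c.arrow (n + 1)) :=
  c.isMin.1.rel_getElem n

lemma arrow_inj {c : G.MinZeroCycle} {m n : ℕ} (hm : m ≤ c.pred) (hn : n ≤ c.pred) :
    c.arrow m = c.arrow n ↔ m = n := by
  have := c.length_arrows
  simp only [arrow]
  rw [c.isMin.2.getElem_inj_iff, Nat.mod_eq_of_lt (by omega), Nat.mod_eq_of_lt (by omega)]

lemma arrow_pred_succ (c : G.MinZeroCycle) : c.arrow (c.pred + 1) = c.arrow 0 := by
  simp [arrow, ← length_arrows]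

lemma eq_of_isRotated {c c' : G.MinZeroCycle} (h : c.arrows ~r c'.arrows) : c = c' := by
  rw [← Quotient.out_eq c, ← Quotient.out_eq c']
  exact Quotient.sound h

lemma eq_of_arrow_eq (hG : G.Gentle) {c c' : G.MinZeroCycle} {m n : ℕ}
    (h : c.arrow m = c'.arrow n) : c = c' :=
  eq_of_isRotated (c.isMin.isRotated hG c'.isMin (c.arrow_mem m) (h ▸ c'.arrow_mem n))

lemma exists_isRotated {p : List G.A} (hp : G.IsMinZeroCycle p) :
    ∃ c : G.MinZeroCycle, c.arrows ~r p :=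
  ⟨Quotient.mk _ ⟨p, hp⟩, Quotient.mk_out (s := G.cycleSetoid G.IsMinZeroCycle) ⟨p, hp⟩⟩

lemma card_eq (P : ℕ → Prop) :
    Nat.card {c : G.MinZeroCycle // P c.arrows.length} =
      Nat.card (Quotient (G.cycleSetoid fun p => G.IsMinZeroCycle p ∧ P p.length)) := by
  refine Nat.card_eq_of_bijective (fun c => Quotient.mk _ ⟨c.1.arrows, c.1.isMin, c.2⟩) ⟨?_, ?_⟩
  · intro c c' h
    exact Subtype.ext (eq_of_isRotated (Quotient.exact h))
  · intro q
    induction q using Quotient.inductionOn with | h p => ?_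
    obtain ⟨p, hp, hP⟩ := p
    obtain ⟨c, hc⟩ := exists_isRotated hp
    exact ⟨⟨c, hc.perm.length_eq ▸ hP⟩, Quotient.sound hc⟩

end MinZeroCycle

lemma oc_eq : Nat.card {c : G.MinZeroCycle // Odd c.arrows.length} = G.oc :=
  MinZeroCycle.card_eq _

lemma ec_eq : Nat.card {c : G.MinZeroCycle // Even c.arrows.length} = G.ec :=
  MinZeroCycle.card_eq _

/-- The zero relations, without those from the last arrow of a cycle to its first one. -/
def CutRel (G : QuivRel) (a b : G.A) : Prop :=
  G.rel a b ∧ ∀ c : G.MinZeroCycle, a ≠ c.arrow c.pred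

open Classical in
/-- The matrix of `CutRel`. -/
noncomputable def cutMatrix (G : QuivRel) : Matrix G.A G.A ℤ :=
  of fun a b => if G.CutRel a b then 1 else 0

/-- The incidence matrix of arrows and the cycles of which they are the last arrow. -/
noncomputable def lastMatrix (G : QuivRel) : Matrix G.A G.MinZeroCycle ℤ :=
  of fun a c => if a = c.arrow c.pred then 1 else 0

/-- The incidence matrix of cycles and their first arrows. -/
noncomputable def firstMatrix (G : QuivRel) : Matrix G.MinZeroCycle G.A ℤ :=
  of fun c a => if a = c.arrow 0 then 1 else 0

/-- The solution `X` of `(1 + G.cutMatrix) * X = G.lastMatrix`. -/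
noncomputable def signMatrix (G : QuivRel) : Matrix G.A G.MinZeroCycle ℤ :=
  of fun a c => ∑ i ∈ Finset.range (c.pred + 1), if a = c.arrow i then (-1) ^ (c.pred - i) else 0

lemma relMatrix_eq (hG : G.Gentle) :
    G.relMatrix = G.cutMatrix + G.lastMatrix * G.firstMatrix := by
  classical
  ext a b
  simp only [relMatrix, cutMatrix, lastMatrix, firstMatrix, mul_apply, of_apply, Matrix.add_apply,
    CutRel]
  by_cases ha : ∃ c : G.MinZeroCycle, a = c.arrow c.pred
  · obtain ⟨c, rfl⟩ := ha
    have h₁ : ¬ ∀ c' : G.MinZeroCycle, c.arrow c.pred ≠ c'.arrow c'.pred := fun h => h c rfl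
    have h₂ : G.rel (c.arrow c.pred) b ↔ b = c.arrow 0 := by
      have := c.rel_arrow c.pred
      rw [c.arrow_pred_succ] at this
      exact ⟨fun h => hG.2.1 _ _ _ h this, fun h => h ▸ this⟩
    rw [Finset.sum_eq_single c]
    · simp [h₁, h₂]
    · intro c' _ hc'
      rw [if_neg fun h => hc' (MinZeroCycle.eq_of_arrow_eq hG h).symm, zero_mul]
    · simp
  · push Not at ha
    simp [ha]

lemma det_one_add_cutMatrix (hG : G.Gentle) : (1 + G.cutMatrix).det = 1 := by
  classical
  refine det_one_add_eq_one_of_lt _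
    (fun a => (Finset.univ.filter (Relation.TransGen G.CutRel a)).card) fun a b hab => ?_
  have hab : G.CutRel a b := by
    by_contra h
    simp [cutMatrix, h] at hab
  refine Finset.card_lt_card (Finset.ssubset_iff_of_subset ?_ |>.2 ⟨b, ?_, ?_⟩)
  · intro c
    simpa using fun h => Relation.TransGen.head hab h
  · simpa using Relation.TransGen.single hab
  · simp only [Finset.mem_filter, Finset.mem_univ, true_and]
    intro h
    obtain ⟨p, hp, hcut⟩ := IsMinZeroCycle.exists_of_transGen hG (fun _ _ h => h.1) h
    obtain ⟨c, hc⟩ := MinZeroCycle.exists_isRotated hp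
    obtain ⟨-, -, h⟩ := hcut _ (hc.mem_iff.1 (c.arrow_mem c.pred))
    exact h c rfl

lemma cutRel_arrow_succ (hG : G.Gentle) {a : G.A} {c : G.MinZeroCycle} {i : ℕ}
    (hi : i < c.pred) : G.CutRel a (c.arrow (i + 1)) ↔ a = c.arrow i := by
  refine ⟨fun h => hG.2.2 _ _ _ h.1 (c.rel_arrow i), ?_⟩
  rintro rfl
  refine ⟨c.rel_arrow i, fun c' h => ?_⟩
  obtain rfl := MinZeroCycle.eq_of_arrow_eq hG h
  exact hi.ne ((MinZeroCycle.arrow_inj hi.le le_rfl).1 h)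

lemma not_cutRel_arrow_zero (hG : G.Gentle) {a : G.A} {c : G.MinZeroCycle} :
    ¬ G.CutRel a (c.arrow 0) := by
  rintro ⟨h, h'⟩
  rw [← c.arrow_pred_succ] at h
  exact h' c (hG.2.2 _ _ _ h (c.rel_arrow _))

lemma one_add_cutMatrix_mul_signMatrix (hG : G.Gentle) :
    (1 + G.cutMatrix) * G.signMatrix = G.lastMatrix := by
  classical
  rw [Matrix.add_mul, Matrix.one_mul]
  ext a c
  have h₁ : (G.cutMatrix * G.signMatrix) a c = ∑ i ∈ Finset.range (c.pred + 1),
      if G.CutRel a (c.arrow i) then (-1) ^ (c.pred - i) else 0 := by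
    simp only [cutMatrix, signMatrix, mul_apply, of_apply, Finset.mul_sum]
    rw [Finset.sum_comm]
    simp
  rw [Matrix.add_apply, h₁, Finset.sum_range_succ', if_neg (not_cutRel_arrow_zero hG)]
  simp only [signMatrix, lastMatrix, of_apply]
  rw [Finset.sum_range_succ, add_zero, add_right_comm, ← Finset.sum_add_distrib,
    Finset.sum_eq_zero, zero_add, Nat.sub_self, pow_zero]
  intro i hi
  have hi := Finset.mem_range.1 hi
  simp only [cutRel_arrow_succ hG hi]
  split_ifs
  · rw [show c.pred - i = c.pred - (i + 1) + 1 by omega, pow_succ]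
    ring
  · rfl

lemma one_add_cutMatrix_mul (hG : G.Gentle) :
    (1 + G.cutMatrix) * (1 + G.signMatrix * G.firstMatrix) = 1 + G.relMatrix := by
  rw [Matrix.mul_add, Matrix.mul_one, ← Matrix.mul_assoc, one_add_cutMatrix_mul_signMatrix hG,
    relMatrix_eq hG, add_assoc]

lemma one_add_firstMatrix_mul_signMatrix (hG : G.Gentle) :
    1 + G.firstMatrix * G.signMatrix =
      diagonal fun c : G.MinZeroCycle => if Odd c.arrows.length then 2 else 0 := by
  ext c c'
  have h₁ : (G.firstMatrix * G.signMatrix) c c' = ∑ i ∈ Finset.range (c'.pred + 1),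
      if c.arrow 0 = c'.arrow i then (-1) ^ (c'.pred - i) else 0 := by
    simp [firstMatrix, signMatrix, mul_apply]
  rw [Matrix.add_apply, h₁]
  by_cases h : c = c'
  · subst h
    rw [Finset.sum_eq_single 0]
    · rw [one_apply_eq, diagonal_apply_eq, if_pos rfl, Nat.sub_zero, c.length_arrows]
      rcases Nat.even_or_odd c.pred with h | h <;> simp [h, Nat.odd_add_one]
    · intro i hi hi'
      have hi := Finset.mem_range_succ_iff.1 hi
      exact if_neg fun h => hi' ((MinZeroCycle.arrow_inj (Nat.zero_le _) hi).1 h).symm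
    · simp
  · rw [one_apply_ne h, diagonal_apply_ne _ h, Finset.sum_eq_zero, zero_add]
    intro i _
    exact if_neg fun h' => h (MinZeroCycle.eq_of_arrow_eq hG h')

lemma exists_pathsFrom_mul_eq (hG : G.Gentle) (hfd : G.FinDim) :
    ∃ W : Matrix G.A G.A ℤ, W.det = 1 ∧
      1 + G.pathsFrom * G.srcMatrix = W * (1 + G.signMatrix * G.firstMatrix) := by
  have hN := det_one_sub_followsMatrix hfd
  refine ⟨(1 - G.followsMatrix)⁻¹ * (1 + G.cutMatrix), ?_, ?_⟩
  · rw [det_mul, det_nonsing_inv, hN, det_one_add_cutMatrix hG, Ring.inverse_one, one_mul]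
  · rw [Matrix.mul_assoc, one_add_cutMatrix_mul hG, ← one_sub_followsMatrix_mul hfd,
      nonsing_inv_mul_cancel_left _ _ (hN ▸ isUnit_one)]

lemma det_cartan_nonneg (hG : G.Gentle) (hfd : G.FinDim) : 0 ≤ G.cartan.det := by
  obtain ⟨W, hW, h⟩ := exists_pathsFrom_mul_eq hG hfd
  rw [cartan_eq hfd, det_one_add_mul_comm, h, det_mul, hW, one_mul, det_one_add_mul_comm,
    one_add_firstMatrix_mul_signMatrix hG, det_diagonal]
  exact Finset.prod_nonneg fun c _ => by split_ifs <;> simp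

lemma exists_cartan_mul_mul_cartan_eq (hG : G.Gentle) (hfd : G.FinDim) :
    ∃ Z, G.cartan * Z * G.cartan = (2 : ℤ) • G.cartan := by
  obtain ⟨W, hW, h⟩ := exists_pathsFrom_mul_eq hG hfd
  rw [cartan_eq hfd]
  refine exists_mul_mul_eq_two_smul_comm _ _ ?_
  obtain ⟨Z, hZ⟩ := exists_mul_mul_eq_two_smul_comm G.firstMatrix G.signMatrix ⟨1, by
    rw [one_add_firstMatrix_mul_signMatrix hG, Matrix.mul_one, diagonal_mul_diagonal,
      ← diagonal_smul]
    congr 1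
    ext c
    by_cases hc : Odd c.arrows.length <;> simp [hc]⟩
  refine ⟨Z * W⁻¹, ?_⟩
  rw [h, ← Matrix.mul_smul, ← hZ]
  simp only [Matrix.mul_assoc]
  rw [nonsing_inv_mul_cancel_left _ _ (hW ▸ isUnit_one)]

lemma rank_cartan_map (hG : G.Gentle) (hfd : G.FinDim) (F : Type*) [Field F] :
    (G.cartan.map (Int.castRingHom F)).rank + Nat.card {c : G.MinZeroCycle //
      ((if Odd c.arrows.length then 2 else 0 : ℤ) : F) = 0} = Fintype.card G.V := by
  classical
  obtain ⟨W, hW, h⟩ := exists_pathsFrom_mul_eq hG hfd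
  have hmap {m n : Type} [Fintype m] [DecidableEq m] [Fintype n] (X : Matrix m n ℤ)
      (Y : Matrix n m ℤ) : (1 + X * Y).map (Int.castRingHom F) =
        1 + X.map (Int.castRingHom F) * Y.map (Int.castRingHom F) := by
    rw [Matrix.map_add _ (map_add _), Matrix.map_mul, Matrix.map_one _ (map_zero _) (map_one _)]
  have h₁ := rank_one_add_mul_comm (G.srcMatrix.map (Int.castRingHom F))
    (G.pathsFrom.map (Int.castRingHom F))
  have h₂ := rank_one_add_mul_comm (G.signMatrix.map (Int.castRingHom F))
    (G.firstMatrix.map (Int.castRingHom F))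
  rw [← hmap, ← hmap, ← cartan_eq hfd, h, Matrix.map_mul, rank_mul_eq_right_of_isUnit_det] at h₁
  · rw [← hmap, ← hmap, one_add_firstMatrix_mul_signMatrix hG, diagonal_map (map_zero _),
      rank_diagonal] at h₂
    have h₃ := Fintype.card_subtype_compl fun c : G.MinZeroCycle =>
      ((if Odd c.arrows.length then 2 else 0 : ℤ) : F) = 0
    have h₄ := Fintype.card_subtype_le fun c : G.MinZeroCycle =>
      ((if Odd c.arrows.length then 2 else 0 : ℤ) : F) = 0
    simp only [Nat.card_eq_fintype_card, eq_intCast, ne_eq] at *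
    omega
  · rw [← RingHom.mapMatrix_apply, ← RingHom.map_det, hW, map_one]
    exact isUnit_one

lemma card_eq_of_unimodEquiv (hG : G.Gentle) (hfd : G.FinDim) {d : G.V → ℤ}
    (hd : UnimodEquiv G.cartan (diagonal d)) (F : Type*) [Field F] :
    Nat.card {v // (d v : F) = 0} = Nat.card {c : G.MinZeroCycle //
      ((if Odd c.arrows.length then 2 else 0 : ℤ) : F) = 0} := by
  classical
  obtain ⟨P, Q, hP, hQ, h⟩ := hd
  have hunit {M : Matrix G.V G.V ℤ} (hM : M.det = 1) :
      IsUnit (M.map (Int.castRingHom F)).det := by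
    rw [← RingHom.mapMatrix_apply, ← RingHom.map_det, hM, map_one]
    exact isUnit_one
  have h₁ := congrArg (fun M => (M.map (Int.castRingHom F)).rank) h
  simp only [Matrix.map_mul, diagonal_map (map_zero _)] at h₁
  rw [rank_mul_eq_left_of_isUnit_det _ _ (hunit hQ), rank_mul_eq_right_of_isUnit_det _ _ (hunit hP),
    rank_diagonal] at h₁
  have h₂ := rank_cartan_map hG hfd F
  have h₃ := Fintype.card_subtype_compl fun v => (d v : F) = 0
  have h₄ := Fintype.card_subtype_le fun v => (d v : F) = 0
  simp only [Nat.card_eq_fintype_card, eq_intCast, ne_eq] at *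
  omega

end QuivRel

/-- The Smith normal form over `ℤ` of the ordinary Cartan matrix of a
(finite-dimensional) gentle algebra `A = KQ/I` is the diagonal matrix with
`oc(Q,I)` entries `2`, `ec(Q,I)` entries `0`, and all remaining entries `1`;
i.e. the elementary divisors of `C_A` are `2` with multiplicity `oc(Q,I)`,
`0` with multiplicity `ec(Q,I)` and `1` otherwise. -/
theorem cartan_smithNormalForm (G : QuivRel) (hG : G.Gentle) (hfd : G.FinDim) :
    ∃ d : G.V → ℤ,
      UnimodEquiv G.cartan (Matrix.diagonal d) ∧
      (∀ v : G.V, d v = 0 ∨ d v = 1 ∨ d v = 2) ∧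
      Nat.card {v : G.V // d v = 2} = G.oc ∧
      Nat.card {v : G.V // d v = 0} = G.ec := by
  obtain ⟨d, hd, hd'⟩ := Matrix.exists_unimodEquiv_diagonal G.cartan
    (QuivRel.det_cartan_nonneg hG hfd) (QuivRel.exists_cartan_mul_mul_cartan_eq hG hfd)
  have hzero : Nat.card {v // d v = 0} = G.ec := by
    have h := QuivRel.card_eq_of_unimodEquiv hG hfd hd ℚ
    rw [← QuivRel.ec_eq]
    simpa only [Int.cast_eq_zero, ite_eq_right_iff, OfNat.ofNat_ne_zero, imp_false,
      Nat.not_odd_iff_even] using h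
  have heven : Nat.card {v // d v = 0 ∨ d v = 2} = Nat.card G.MinZeroCycle := by
    have h := QuivRel.card_eq_of_unimodEquiv hG hfd hd (ZMod 2)
    have h₁ (v) : ((d v : ZMod 2) = 0) ↔ (d v = 0 ∨ d v = 2) := by
      rcases hd' v with e | e | e <;> rw [e] <;> decide
    have h₂ (c : G.MinZeroCycle) :
        ((if Odd c.arrows.length then 2 else 0 : ℤ) : ZMod 2) = 0 := by
      split_ifs <;> decide
    simp only [h₁, h₂] at h
    rw [h]
    exact Nat.card_congr (Equiv.subtypeUnivEquiv fun _ => trivial)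
  refine ⟨d, hd, hd', ?_, hzero⟩
  have h₁ : Nat.card {v // d v = 0 ∨ d v = 2} =
      Nat.card {v // d v = 0} + Nat.card {v // d v = 2} := by
    simp only [Nat.card_eq_fintype_card]
    refine Fintype.card_subtype_or_disjoint _ _ (Pi.disjoint_iff.2 fun v => ?_)
    simp only [Prop.disjoint_iff]
    omega
  have h₂ : Nat.card G.MinZeroCycle = G.ec + G.oc := by
    classical
    rw [← QuivRel.ec_eq, ← QuivRel.oc_eq, ← Nat.card_sum]
    simp only [← Nat.not_even_iff_odd]
    exact Nat.card_congr (Equiv.sumCompl _).symm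
  omega
end

section
/- Let (Q,I) be a gentle quiver over a field K such that A = KQ/I is finite-dimensional. Then for each vertex v of Q there is at most one nontrivial cyclic path from v to v which is nonzero in A; consequently, every diagonal entry of the q-Cartan matrix C_A(q) is either 1 or of the form 1 + q^j for some j ≥ 1. -/
namespace QuivRel

/-- A right-unique chain is determined by its head, up to its length. -/
theorem _root_.List.IsChain.prefix_or_prefix {α : Type*} {R : α → α → Prop}
    (hR : ∀ a b c, R a b → R a c → b = c) (a : α) (l m : List α)
    (hl : (a :: l).IsChain R) (hm : (a :: m).IsChain R) :
    a :: l <+: a :: m ∨ a :: m <+: a :: l := by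
  induction l generalizing a m with
  | nil => exact Or.inl (by simp)
  | cons b l ih =>
    cases m with
    | nil => exact Or.inr (by simp)
    | cons c m =>
      rw [List.isChain_cons_cons] at hl hm
      obtain rfl := hR a b c hl.1 hm.1
      simpa [List.prefix_cons_inj] using ih b m hl.2 hm.2

/-- Repeating a closed chain yields a chain. -/
theorem _root_.List.IsChain.flatten_replicate {α : Type*} {R : α → α → Prop} {p : List α}
    (hp : p.IsChain R) (hc : ∀ x ∈ p.getLast?, ∀ y ∈ p.head?, R x y) (n : ℕ) :
    (List.replicate n p).flatten.IsChain R := by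
  induction n with
  | zero => simp
  | succ n ih =>
    rw [List.replicate_succ, List.flatten_cons, List.isChain_append]
    refine ⟨hp, ih, fun x hx y hy => hc x hx y ?_⟩
    rcases n with _ | n
    · simp at hy
    · rcases p with _ | ⟨a, p⟩
      · simp at hx
      · simpa [List.replicate_succ] using hy

variable {G : QuivRel}

/-- In a finite-dimensional algebra, no nonzero path closes up to a cycle without relations. -/
theorem FinDim.eq_nil_of_closed (hfd : G.FinDim) {p : List G.A} (hp : G.IsNonzeroPath p)
    (hc : ∀ x ∈ p.getLast?, ∀ y ∈ p.head?, G.tgt x = G.src y ∧ ¬ G.rel x y) : p = [] := by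
  obtain ⟨N, hN⟩ := hfd
  have h := hN _ (List.IsChain.flatten_replicate hp hc (N + 1))
  simp only [List.length_flatten, List.map_replicate, List.sum_replicate, smul_eq_mul] at h
  by_contra hne
  have := List.length_pos_iff.2 hne
  nlinarith

/-- The last and the first arrow of a nontrivial nonzero cyclic path form a relation. -/
theorem FinDim.rel_getLast_head (hfd : G.FinDim) {v : G.V} {p : List G.A} {a b : G.A}
    (hp : G.IsNonzeroPathFrom v v p) (ha : a ∈ p.head?) (hb : b ∈ p.getLast?) :
    G.rel b a := by
  by_contra h
  have := hfd.eq_nil_of_closed hp.1 fun x hx y hy => by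
    obtain rfl := Option.mem_unique hx hb
    obtain rfl := Option.mem_unique hy ha
    exact ⟨(hp.2.2.1 _ hx).trans (hp.2.1 _ hy).symm, h⟩
  simp [this] at ha

/-- A nonzero path that extends another one and ends with the same arrow is equal to it. -/
theorem FinDim.eq_of_prefix (hfd : G.FinDim) {p q : List G.A} {b : G.A}
    (hq : G.IsNonzeroPath q) (hpq : p <+: q) (hb : b ∈ p.getLast?) (hb' : b ∈ q.getLast?) :
    p = q := by
  obtain ⟨r, rfl⟩ := hpq
  obtain ⟨-, hr, h⟩ := List.isChain_append.1 hq
  have : r = [] := hfd.eq_nil_of_closed hr fun x hx y hy => by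
    have hx' : x ∈ (p ++ r).getLast? := by
      rw [Option.mem_def] at hx
      simp [List.getLast?_append, hx]
    obtain rfl := Option.mem_unique hx' hb'
    exact h _ hb y hy
  simp [this]

theorem Gentle.cyclic_path_unique (hG : G.Gentle) (hfd : G.FinDim) {v : G.V} {p q : List G.A}
    (hp0 : p ≠ []) (hq0 : q ≠ []) (hp : G.IsNonzeroPathFrom v v p)
    (hq : G.IsNonzeroPathFrom v v q) : p = q := by
  obtain ⟨⟨-, -, hR, -⟩, h1, h2⟩ := hG
  obtain ⟨a, p', rfl⟩ := List.exists_cons_of_ne_nil hp0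
  obtain ⟨c, q', rfl⟩ := List.exists_cons_of_ne_nil hq0
  obtain ⟨b, hb⟩ : ∃ b, b ∈ (a :: p').getLast? := ⟨_, List.getLast?_eq_some_getLast hp0⟩
  obtain ⟨d, hd⟩ : ∃ d, d ∈ (c :: q').getLast? := ⟨_, List.getLast?_eq_some_getLast hq0⟩
  have hba : G.rel b a := hfd.rel_getLast_head hp (by simp) hb
  have hdc : G.rel d c := hfd.rel_getLast_head hq (by simp) hd
  by_cases hac : a = c
  · subst hac
    obtain rfl := h2 _ _ _ hba hdc
    rcases List.IsChain.prefix_or_prefix (fun x y z hy hz => hR x y z hy.1 hy.2 hz.1 hz.2)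
      a p' q' hp.1 hq.1 with h | h
    · exact hfd.eq_of_prefix hq.1 h hb hd
    · exact (hfd.eq_of_prefix hp.1 h hd hb).symm
  · have hbc : ¬ G.rel b c := fun h => hac (h1 _ _ _ hba h)
    have hda : ¬ G.rel d a := fun h => hac (h1 _ _ _ h hdc)
    have hsa : G.src a = v := hp.2.1 a (by simp)
    have hsc : G.src c = v := hq.2.1 c (by simp)
    have hpq : G.IsNonzeroPath ((a :: p') ++ (c :: q')) :=
      List.isChain_append.2 ⟨hp.1, hq.1, fun x hx y hy => by
        obtain rfl := Option.mem_unique hx hb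
        obtain rfl : c = y := by simpa using hy
        exact ⟨(hp.2.2.1 _ hx).trans hsc.symm, hbc⟩⟩
    have := hfd.eq_nil_of_closed hpq fun x hx y hy => by
      have hd' : d ∈ ((a :: p') ++ (c :: q')).getLast? := by
        rw [Option.mem_def] at hd
        rw [Option.mem_def, List.getLast?_append, hd, Option.some_or]
      obtain rfl := Option.mem_unique hx hd'
      obtain rfl : a = y := by simpa using hy
      exact ⟨(hq.2.2.1 _ hd).trans hsa.symm, hda⟩
    simp at this

/-- The trivial path is the only path of length zero from a vertex to itself. -/
theorem card_nonzeroPathFrom_zero (v : G.V) :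
    Nat.card {p : List G.A // p.length = 0 ∧ G.IsNonzeroPathFrom v v p} = 1 := by
  rw [Nat.card_eq_one_iff_unique]
  refine ⟨⟨fun p q => Subtype.ext ?_⟩, ⟨⟨[], rfl, ?_⟩⟩⟩
  · rw [List.length_eq_zero_iff.1 p.2.1, List.length_eq_zero_iff.1 q.2.1]
  · exact ⟨List.isChain_nil, by simp⟩

theorem qCartan_diag_eq_one {v : G.V} (h : ∀ p, G.IsNonzeroPathFrom v v p → p = []) :
    G.qCartan v v = 1 := by
  unfold qCartan
  rw [finsum_eq_single _ 0, card_nonzeroPathFrom_zero]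
  · simp
  · intro n hn
    have : IsEmpty {p : List G.A // p.length = n ∧ G.IsNonzeroPathFrom v v p} :=
      ⟨fun p => hn (by rw [← p.2.1, h _ p.2.2, List.length_nil])⟩
    simp

theorem qCartan_diag_eq_one_add {v : G.V} {p : List G.A} (hp0 : p ≠ [])
    (hp : G.IsNonzeroPathFrom v v p)
    (h : ∀ q, q ≠ [] → G.IsNonzeroPathFrom v v q → q = p) :
    G.qCartan v v = 1 + Polynomial.X ^ p.length := by
  have hcard : Nat.card {q : List G.A // q.length = p.length ∧ G.IsNonzeroPathFrom v v q} = 1 := by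
    rw [Nat.card_eq_one_iff_unique]
    have key (q : {q : List G.A // q.length = p.length ∧ G.IsNonzeroPathFrom v v q}) :
        q.1 = p := h _ (fun h0 => hp0 (List.length_eq_zero_iff.1 (by simp [← q.2.1, h0]))) q.2.2
    exact ⟨⟨fun q r => Subtype.ext ((key q).trans (key r).symm)⟩, ⟨⟨p, rfl, hp⟩⟩⟩
  unfold qCartan
  rw [finsum_eq_sum_of_support_subset (s := {0, p.length}), Finset.sum_pair,
    card_nonzeroPathFrom_zero, hcard]
  · simp
  · exact (List.length_pos_iff.2 hp0).ne
  · intro n hn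
    by_contra hn'
    simp only [Finset.coe_insert, Finset.coe_singleton, Set.mem_insert_iff,
      Set.mem_singleton_iff, not_or] at hn'
    have : IsEmpty {q : List G.A // q.length = n ∧ G.IsNonzeroPathFrom v v q} :=
      ⟨fun q => hn'.2 (by
        rw [← q.2.1, h _ (fun h0 => hn'.1 (by rw [← q.2.1, h0, List.length_nil])) q.2.2])⟩
    simp at hn

end QuivRel

/-- In a gentle quiver `(Q,I)` with `A = KQ/I` finite-dimensional, for each
vertex `v` there is at most one nontrivial cyclic path from `v` to `v` which is
nonzero in `A`; consequently every diagonal entry of the `q`-Cartan matrix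
`C_A(q)` is either `1` or of the form `1 + q^j` with `j ≥ 1`. -/
theorem qCartan_diagonal_entries (G : QuivRel) (hG : G.Gentle) (hfd : G.FinDim) :
    (∀ v : G.V, ∀ p q : List G.A, p ≠ [] → q ≠ [] →
      G.IsNonzeroPathFrom v v p → G.IsNonzeroPathFrom v v q → p = q) ∧
    (∀ v : G.V, G.qCartan v v = 1 ∨
      ∃ j : ℕ, 1 ≤ j ∧ G.qCartan v v = 1 + Polynomial.X ^ j) := by
  refine ⟨fun v p q hp0 hq0 hp hq => hG.cyclic_path_unique hfd hp0 hq0 hp hq, fun v => ?_⟩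
  by_cases h : ∃ p, p ≠ [] ∧ G.IsNonzeroPathFrom v v p
  · obtain ⟨p, hp0, hp⟩ := h
    exact Or.inr ⟨p.length, List.length_pos_iff.2 hp0, QuivRel.qCartan_diag_eq_one_add hp0 hp
      fun q hq0 hq => hG.cyclic_path_unique hfd hq0 hp0 hq hp⟩
  · push Not at h
    exact Or.inl (QuivRel.qCartan_diag_eq_one fun p hp => by_contra fun hp0 => h p hp0 hp)
end

section
/- Let (Q,I) be a gentle quiver such that KQ/I is finite-dimensional and Q has at least one vertex. Then not every vertex of Q has valency 4; i.e., Q possesses a vertex of valency at most 3. -/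
namespace QuivRel

/-- If every arrow can be prolonged by some arrow without meeting a relation, then
nonzero paths of every positive length start with any given arrow. -/
theorem exists_isNonzeroPath_cons (G : QuivRel)
    (h : ∀ a : G.A, ∃ b, G.tgt a = G.src b ∧ ¬ G.rel a b) (n : ℕ) (a : G.A) :
    ∃ p : List G.A, G.IsNonzeroPath (a :: p) ∧ p.length = n := by
  induction n generalizing a with
  | zero => exact ⟨[], List.isChain_singleton a, rfl⟩
  | succ n ih =>
    obtain ⟨b, hb⟩ := h a
    obtain ⟨p, hp, hn⟩ := ih b
    exact ⟨b :: p, List.isChain_cons_cons.2 ⟨hb, hp⟩, by simp [hn]⟩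

/-- If an arrow has at most one zero continuation and two arrows start at its end,
then it has a nonzero continuation. -/
theorem exists_nonzero_continuation (G : QuivRel)
    (hrel : ∀ a b c : G.A, G.rel a b → G.rel a c → b = c) (a : G.A)
    (hout : 1 < Nat.card {b : G.A // G.src b = G.tgt a}) :
    ∃ b, G.tgt a = G.src b ∧ ¬ G.rel a b := by
  obtain ⟨⟨b, hb⟩, ⟨c, hc⟩, hbc⟩ := (Finite.one_lt_card_iff_nontrivial.1 hout).exists_pair_ne
  by_contra! h
  exact hbc (Subtype.ext (hrel a b c (h b hb.symm) (h c hc.symm)))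

end QuivRel

/-- Let `(Q,I)` be a gentle quiver such that `KQ/I` is finite-dimensional and
`Q` has at least one vertex.  Then not every vertex of `Q` has valency `4`:
some vertex has valency (number of incoming plus outgoing arrows) at most `3`. -/
theorem exists_vertex_valency_le_three (G : QuivRel) (hG : G.Gentle) (hfd : G.FinDim)
    (hne : Nonempty G.V) :
    ∃ v : G.V,
      Nat.card {a : G.A // G.src a = v} + Nat.card {a : G.A // G.tgt a = v} ≤ 3 := by
  by_contra! hval
  obtain ⟨⟨-, hin, -, -⟩, hrel, -⟩ := hG
  have hout (v : G.V) : 1 < Nat.card {a : G.A // G.src a = v} := by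
    have := hval v
    have := hin v
    omega
  obtain ⟨v⟩ := hne
  obtain ⟨⟨⟨a, -⟩⟩, -⟩ := Nat.card_pos_iff.1 (zero_lt_one.trans (hout v))
  obtain ⟨N, hN⟩ := hfd
  obtain ⟨p, hp, hlen⟩ := G.exists_isNonzeroPath_cons
    (fun a => G.exists_nonzero_continuation hrel a (hout _)) N a
  have := hN _ hp
  rw [List.length_cons] at this
  omega
end
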